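/- Let C be the block matrix C = [[−D, S],[H, D']] acting on ℝ^{∂Ω} × ℝ^{∂Ω}, and let P± = I/2 ∓ C where I is the identity on ℝ^{∂Ω} × ℝ^{∂Ω}. Then (P⁺)² = P⁺ and (P⁻)² = P⁻; equivalently C² = I/4. -/

import Mathlib

open Matrix BigOperators

noncomputable section

variable {V : Type*} [Fintype V] [DecidableEq V]

/-- Weighted graph Laplacian of a symmetric weight function. -/
def lap (σ : V → V → ℝ) : Matrix V V ℝ :=
  Matrix.of fun x y => if x = y then ∑ z, σ x z else -σ x y

/-- Restriction matrix `R_X : ℝ^V → ℝ^X`. -/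
def restr (X : Finset V) : Matrix {x // x ∈ X} V ℝ :=
  Matrix.of fun i j => if (i : V) = j then 1 else 0

/-- Green function `G = R_{V°}ᵀ (L[V°,V°])⁻¹ R_{V°}` with `V° = Bᶜ`. -/
def green (B : Finset V) (σ : V → V → ℝ) : Matrix V V ℝ :=
  (restr Bᶜ)ᵀ * (restr Bᶜ * lap σ * (restr Bᶜ)ᵀ)⁻¹ * restr Bᶜ

/-- Dirichlet trace operator `γ₀ = R_{∂Ω}`. -/
def gamma0 (dO : Finset V) : Matrix {x // x ∈ dO} V ℝ := restr dO

/-- Exterior Neumann trace operator `γ₁⁺ = -R_{∂Ω} L(σ⁺)`. -/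
def gamma1p (dO : Finset V) (σp : V → V → ℝ) : Matrix {x // x ∈ dO} V ℝ :=
  -(restr dO * lap σp)

/-- Interior Neumann trace operator `γ₁⁻ = R_{∂Ω} L(σ⁻)`. -/
def gamma1m (dO : Finset V) (σm : V → V → ℝ) : Matrix {x // x ∈ dO} V ℝ :=
  restr dO * lap σm

/-- Single layer potential `𝒮 = G γ₀ᵀ`. -/
def slp (B dO : Finset V) (σ : V → V → ℝ) : Matrix V {x // x ∈ dO} ℝ :=
  green B σ * (gamma0 dO)ᵀ

/-- Exterior double layer potential `𝒟⁺ = G (γ₁⁺)ᵀ`. -/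
def dlpP (B dO : Finset V) (σ σp : V → V → ℝ) : Matrix V {x // x ∈ dO} ℝ :=
  green B σ * (gamma1p dO σp)ᵀ

/-- Interior double layer potential `𝒟⁻ = G (γ₁⁻)ᵀ`. -/
def dlpM (B dO : Finset V) (σ σm : V → V → ℝ) : Matrix V {x // x ∈ dO} ℝ :=
  green B σ * (gamma1m dO σm)ᵀ

/-- Single layer boundary operator `S = γ₀ 𝒮`. -/
def Sop (B dO : Finset V) (σ : V → V → ℝ) : Matrix {x // x ∈ dO} {x // x ∈ dO} ℝ :=
  gamma0 dO * slp B dO σ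

/-- Double layer boundary operator `D = ½ γ₀ (𝒟⁺ + 𝒟⁻)`. -/
def Dop (B dO : Finset V) (σ σp σm : V → V → ℝ) : Matrix {x // x ∈ dO} {x // x ∈ dO} ℝ :=
  (1/2 : ℝ) • (gamma0 dO * (dlpP B dO σ σp + dlpM B dO σ σm))

/-- Adjoint double layer (Neumann–Poincaré) operator `D' = ½ (γ₁⁺ + γ₁⁻) 𝒮`. -/
def Dadj (B dO : Finset V) (σ σp σm : V → V → ℝ) : Matrix {x // x ∈ dO} {x // x ∈ dO} ℝ :=
  (1/2 : ℝ) • ((gamma1p dO σp + gamma1m dO σm) * slp B dO σ)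

/-- Hypersingular operator `H = -γ₁⁺ 𝒟⁻`. -/
def Hop (B dO : Finset V) (σ σp σm : V → V → ℝ) : Matrix {x // x ∈ dO} {x // x ∈ dO} ℝ :=
  -(gamma1p dO σp * dlpM B dO σ σm)

/-- Indicator vector of a node subset. -/
def ind (X : Finset V) : V → ℝ := fun x => if x ∈ X then 1 else 0

/-- The subgraph with node set `A` and edges `{x,y}` with `w x y > 0` is connected. -/
def connOn (A : Finset V) (w : V → V → ℝ) : Prop :=
  ∀ x ∈ A, ∀ y ∈ A, Relation.ReflTransGen (fun a b => a ∈ A ∧ b ∈ A ∧ 0 < w a b) x y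

lemma restr_mul_apply {n : Type*} (X : Finset V) (M : Matrix V n ℝ) (i : {x // x ∈ X}) (j : n) :
    (restr X * M) i j = M i j := by
  simp [restr, Matrix.mul_apply]

lemma restr_mul_transpose_self (X : Finset V) : restr X * (restr X)ᵀ = 1 := by
  ext i j
  rw [restr_mul_apply]
  simp only [restr, Matrix.transpose_apply, Matrix.of_apply, Matrix.one_apply, Subtype.ext_iff]
  exact if_congr eq_comm rfl rfl

lemma restr_transpose_mul_self (X : Finset V) :
    (restr X)ᵀ * restr X = Matrix.diagonal (ind X) := by
  ext i j
  by_cases h : i ∈ X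
  · rw [Matrix.mul_apply, Finset.sum_eq_single ⟨i, h⟩]
    · simp [restr, ind, Matrix.diagonal_apply, h]
    · rintro ⟨k, hk⟩ - hne
      have : k ≠ i := fun e => hne (Subtype.ext e)
      simp [restr, this]
    · simp
  · rw [Matrix.mul_apply, Finset.sum_eq_zero]
    · simp [ind, Matrix.diagonal_apply, h]
    · rintro ⟨k, hk⟩ -
      have : k ≠ i := fun e => h (e ▸ hk)
      simp [restr, this]

lemma restr_mul_diagonal_ind {X Y : Finset V} (h : X ⊆ Y) :
    restr X * Matrix.diagonal (ind Y) = restr X := by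
  ext i j
  rw [Matrix.mul_diagonal]
  by_cases hij : (i : V) = j
  · simp [ind, ← hij, h i.2]
  · simp [restr, hij]

lemma restr_mul_diagonal_ind_of_disjoint {X Y : Finset V} (h : Disjoint X Y) :
    restr X * Matrix.diagonal (ind Y) = 0 := by
  ext i j
  rw [Matrix.mul_diagonal]
  by_cases hij : (i : V) = j
  · simp [ind, ← hij, Finset.disjoint_left.mp h i.2]
  · simp [restr, hij]

lemma lap_transpose {σ : V → V → ℝ} (h : ∀ x y, σ x y = σ y x) : (lap σ)ᵀ = lap σ := by
  ext x y
  by_cases hxy : x = y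
  · simp [hxy]
  · simp [lap, hxy, Ne.symm hxy, h x y]

lemma lap_apply_eq_zero {σ : V → V → ℝ} {x : V} (h : ∀ y, σ x y = 0) (y : V) :
    lap σ x y = 0 := by
  simp [lap, h]

lemma lap_add {σ σp σm : V → V → ℝ} (h : ∀ x y, σp x y + σm x y = σ x y) :
    lap σp + lap σm = lap σ := by
  ext x y
  by_cases hxy : x = y
  · simp [lap, hxy, ← h, Finset.sum_add_distrib]
  · simp [lap, hxy, ← h, add_comm]

lemma green_transpose (B : Finset V) {σ : V → V → ℝ} (h : ∀ x y, σ x y = σ y x) :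
    (green B σ)ᵀ = green B σ := by
  simp [green, Matrix.transpose_nonsing_inv, lap_transpose h, Matrix.mul_assoc]

lemma green_mul_diagonal (B : Finset V) (σ : V → V → ℝ) :
    green B σ * Matrix.diagonal (ind Bᶜ) = green B σ := by
  simp [green, Matrix.mul_assoc, restr_mul_diagonal_ind (Finset.Subset.refl _)]

lemma restr_mul_lap_mul_green {B : Finset V} {σ : V → V → ℝ}
    (h : IsUnit (restr Bᶜ * lap σ * (restr Bᶜ)ᵀ)) :
    restr Bᶜ * (lap σ * green B σ) = restr Bᶜ := by
  have := Matrix.mul_nonsing_inv _ ((Matrix.isUnit_iff_isUnit_det _).mp h)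
  calc restr Bᶜ * (lap σ * green B σ)
      = (restr Bᶜ * lap σ * (restr Bᶜ)ᵀ) * (restr Bᶜ * lap σ * (restr Bᶜ)ᵀ)⁻¹ * restr Bᶜ := by
        simp only [green, Matrix.mul_assoc]
    _ = restr Bᶜ := by rw [this, Matrix.one_mul]

lemma diagonal_mul_lap_mul_green {B : Finset V} {σ : V → V → ℝ}
    (h : IsUnit (restr Bᶜ * lap σ * (restr Bᶜ)ᵀ)) :
    Matrix.diagonal (ind Bᶜ) * (lap σ * green B σ) = Matrix.diagonal (ind Bᶜ) := by
  rw [← restr_transpose_mul_self, Matrix.mul_assoc, restr_mul_lap_mul_green h]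

/-- Algebraic form of the Calderón identities: `R` is the boundary trace, `G` a Green function of
`Lp + Lm`, and `P` the projection onto the nodes strictly on the side of `Lp`. -/
lemma calderon_identities {m n : Type*} [Fintype m] [DecidableEq m] [Fintype n]
    {R : Matrix m n ℝ} {G Lp Lm P : Matrix n n ℝ}
    (hG : Gᵀ = G) (hLp : Lpᵀ = Lp) (hLm : Lmᵀ = Lm) (hP : Pᵀ = P)
    (hRR : R * Rᵀ = 1) (hR : R * ((Lp + Lm) * G) = R)
    (hGP : G * (P * ((Lp + Lm) * G)) = G * P)
    (hdec : Lp = P * Lp + Rᵀ * (R * Lp)) (hRP : R * P = 0) (hPm : P * Lm = 0) :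
    let S := R * (G * Rᵀ)
    let H := R * (Lp * (G * (Lm * Rᵀ)))
    let A := R * (Lp * (G * Rᵀ))
    S * A = Aᵀ * S ∧ H * Aᵀ = A * H ∧ S * H = Aᵀ * (1 - Aᵀ) ∧ H * S = A * (1 - A) := by
  intro S H A
  have hPRt : P * Rᵀ = 0 := by
    have := congrArg Matrix.transpose hRP
    simpa [hP] using this
  have hAt : Aᵀ = R * (G * (Lp * Rᵀ)) := by
    simp [A, hG, hLp, Matrix.mul_assoc]
  have hSt : Sᵀ = S := by simp [S, hG, Matrix.mul_assoc]
  have hRt : G * (Lm * Rᵀ) = Rᵀ - G * (Lp * Rᵀ) := by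
    have := congrArg Matrix.transpose hR
    simp only [Matrix.transpose_mul, Matrix.transpose_add, hG, hLp, hLm, Matrix.mul_add,
      Matrix.add_mul, Matrix.mul_assoc] at this
    exact eq_sub_of_add_eq' this
  have hHeq : H = R * (Lp * Rᵀ) - R * (Lp * (G * (Lp * Rᵀ))) := by
    simp only [H, hRt, Matrix.mul_sub]
  have hHt : Hᵀ = H := by
    simp [hHeq, hG, hLp, Matrix.mul_assoc]
  have hX : G * (Rᵀ * (R * (Lp * G))) = G * (Lp * G) - G * P := by
    have h1 : G * (P * (Lp * G)) = G * P := by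
      rw [← hGP, Matrix.add_mul, Matrix.mul_add, ← Matrix.mul_assoc P Lm, hPm]; simp
    have h2 : G * (Lp * G) = G * (P * (Lp * G)) + G * (Rᵀ * (R * (Lp * G))) := by
      conv_lhs => rw [hdec]
      simp only [Matrix.add_mul, Matrix.mul_add, Matrix.mul_assoc]
    rw [h2, h1]; abel
  have hX' : G * (Lp * (Rᵀ * (R * G))) = G * (Lp * G) - P * G := by
    have := congrArg Matrix.transpose hX
    simpa [hG, hLp, hP, Matrix.mul_assoc] using this
  have hXm {k : Type _} (M : Matrix n k ℝ) :
      G * (Rᵀ * (R * (Lp * (G * M)))) = G * (Lp * (G * M)) - G * (P * M) := by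
    have := congrArg (· * M) hX
    simpa only [Matrix.sub_mul, Matrix.mul_assoc] using this
  have hXm' {k : Type _} (M : Matrix n k ℝ) :
      G * (Lp * (Rᵀ * (R * (G * M)))) = G * (Lp * (G * M)) - P * (G * M) := by
    have := congrArg (· * M) hX'
    simpa only [Matrix.sub_mul, Matrix.mul_assoc] using this
  have hPmR : P * (Lm * Rᵀ) = 0 := by rw [← Matrix.mul_assoc, hPm, Matrix.zero_mul]
  have hSA : S * A = R * (G * (Lp * (G * Rᵀ))) := by
    simp only [S, A, Matrix.mul_assoc]
    rw [hXm, hPRt]; simp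
  have hAH : A * H = R * (Lp * (G * (Lp * Rᵀ))) - R * (Lp * (G * (Lp * (G * (Lp * Rᵀ))))) := by
    simp only [H, A, Matrix.mul_assoc]
    rw [hXm, hPmR, hRt]
    simp [Matrix.mul_sub]
  have hSH : S * H = Aᵀ * (1 - Aᵀ) := by
    have h1 : 1 - Aᵀ = R * (G * (Lm * Rᵀ)) := by rw [hRt, Matrix.mul_sub, hRR, hAt]
    rw [h1, hAt]
    simp only [S, H, Matrix.mul_assoc]
    rw [hXm, hXm', hPmR, Matrix.mul_sub, Matrix.mul_sub, ← Matrix.mul_assoc R P, hRP]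
    simp
  refine ⟨?_, ?_, hSH, ?_⟩
  · have h : (S * A)ᵀ = S * A := by rw [hSA]; simp [hG, hLp, Matrix.mul_assoc]
    rw [← h, Matrix.transpose_mul S A, hSt]
  · have h : (A * H)ᵀ = A * H := by rw [hAH]; simp [hG, hLp, Matrix.mul_assoc]
    rw [← h, Matrix.transpose_mul A H, hHt]
  · have := congrArg Matrix.transpose hSH
    rw [Matrix.transpose_mul, hHt, hSt] at this
    rw [this]
    simp [Matrix.mul_sub]

lemma fromBlocks_mul_self_of_calderon {m : Type*} [Fintype m] [DecidableEq m]
    {S H A A' : Matrix m m ℝ} (hSA : S * A = A' * S) (hHA : H * A' = A * H)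
    (hSH : S * H = A' * (1 - A')) (hHS : H * S = A * (1 - A)) :
    Matrix.fromBlocks (A' - (1/2 : ℝ) • 1) S H ((1/2 : ℝ) • 1 - A) *
      Matrix.fromBlocks (A' - (1/2 : ℝ) • 1) S H ((1/2 : ℝ) • 1 - A) = (1/4 : ℝ) • 1 := by
  rw [Matrix.fromBlocks_multiply, ← Matrix.fromBlocks_one, Matrix.fromBlocks_smul, hSH, hHS]
  congr 1 <;>
    simp only [Matrix.mul_sub, Matrix.sub_mul, hSA, hHA, Matrix.smul_mul, Matrix.mul_smul,
      Matrix.mul_one, Matrix.one_mul] <;>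
    module

theorem stmt_8
    {V : Type*} [Fintype V] [DecidableEq V]
    (B Op dO Om : Finset V)
    (hBne : B.Nonempty) (hOpne : Op.Nonempty) (hdOne : dO.Nonempty) (hOmne : Om.Nonempty)
    (hd1 : Disjoint B Op) (hd2 : Disjoint B dO) (hd3 : Disjoint B Om)
    (hd4 : Disjoint Op dO) (hd5 : Disjoint Op Om) (hd6 : Disjoint dO Om)
    (hcover : B ∪ Op ∪ dO ∪ Om = Finset.univ)
    (σ σp σm : V → V → ℝ)
    (hσsymm : ∀ x y, σ x y = σ y x) (hσdiag : ∀ x, σ x x = 0)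
    (hσnn : ∀ x y, 0 ≤ σ x y)
    (hsepBdO : ∀ x ∈ B, ∀ y ∈ dO, σ x y = 0)
    (hsepBOm : ∀ x ∈ B, ∀ y ∈ Om, σ x y = 0)
    (hsepOpOm : ∀ x ∈ Op, ∀ y ∈ Om, σ x y = 0)
    (hσpsymm : ∀ x y, σp x y = σp y x) (hσpdiag : ∀ x, σp x x = 0)
    (hσmsymm : ∀ x y, σm x y = σm y x) (hσmdiag : ∀ x, σm x x = 0)
    (hσpnn : ∀ x y, 0 ≤ σp x y) (hσmnn : ∀ x y, 0 ≤ σm x y)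
    (hsum : ∀ x y, σp x y + σm x y = σ x y)
    (hp1 : ∀ x y, x ∈ B ∪ Op ∨ y ∈ B ∪ Op → σp x y = σ x y)
    (hm1 : ∀ x y, x ∈ Om ∨ y ∈ Om → σm x y = σ x y)
    (hpd : (restr Bᶜ * lap σ * (restr Bᶜ)ᵀ).PosDef) :
    ∀ C Pp Pm : Matrix ({x // x ∈ dO} ⊕ {x // x ∈ dO}) ({x // x ∈ dO} ⊕ {x // x ∈ dO}) ℝ,
      C = Matrix.fromBlocks (-(Dop B dO σ σp σm)) (Sop B dO σ) (Hop B dO σ σp σm) (Dadj B dO σ σp σm) →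
      Pp = (1/2 : ℝ) • 1 - C → Pm = (1/2 : ℝ) • 1 + C →
      Pp * Pp = Pp ∧ Pm * Pm = Pm ∧ C * C = (1/4 : ℝ) • 1 := by
  intro C Pp Pm hC hPp hPm
  have hL := lap_add hsum
  have hG := green_transpose B hσsymm
  have hLp := lap_transpose hσpsymm
  have hLm := lap_transpose hσmsymm
  have hdOB : dO ⊆ Bᶜ := fun x hx => by
    simpa using Finset.disjoint_right.mp hd2 hx
  have hR : restr dO * ((lap σp + lap σm) * green B σ) = restr dO := by
    rw [hL, ← restr_mul_diagonal_ind hdOB, Matrix.mul_assoc,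
      diagonal_mul_lap_mul_green hpd.isUnit]
  set P : Matrix V V ℝ := Matrix.diagonal (ind (B ∪ Op))
  have hGP : green B σ * (P * ((lap σp + lap σm) * green B σ)) = green B σ * P := by
    have hcomm : Matrix.diagonal (ind Bᶜ) * P = P * Matrix.diagonal (ind Bᶜ) := by
      simp [P, Matrix.diagonal_mul_diagonal, mul_comm]
    rw [hL, ← green_mul_diagonal, Matrix.mul_assoc, ← Matrix.mul_assoc _ P, hcomm,
      Matrix.mul_assoc, green_mul_diagonal, diagonal_mul_lap_mul_green hpd.isUnit, ← hcomm,
      ← Matrix.mul_assoc, green_mul_diagonal]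
  have hRP : restr dO * P = 0 :=
    restr_mul_diagonal_ind_of_disjoint (Finset.disjoint_union_right.mpr ⟨hd2.symm, hd4.symm⟩)
  have hPLm : P * lap σm = 0 := by
    ext x y
    rw [Matrix.diagonal_mul]
    by_cases hx : x ∈ B ∪ Op
    · rw [lap_apply_eq_zero fun z => by linarith [hp1 x z (Or.inl hx), hsum x z]]
      simp
    · simp [ind, hx]
  have hdec : lap σp = P * lap σp + (restr dO)ᵀ * (restr dO * lap σp) := by
    rw [← Matrix.mul_assoc, restr_transpose_mul_self]
    ext x y
    rw [Matrix.add_apply, Matrix.diagonal_mul, Matrix.diagonal_mul]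
    have hx : x ∈ B ∪ Op ∪ dO ∪ Om := hcover ▸ Finset.mem_univ x
    rw [Finset.mem_union, Finset.mem_union] at hx
    rcases hx with (hx | hx) | hx
    · have : x ∉ dO := Finset.disjoint_left.mp (Finset.disjoint_union_left.mpr ⟨hd2, hd4⟩) hx
      simp only [ind, hx, this, if_true, if_false]; ring
    · have : x ∉ B ∪ Op :=
        Finset.disjoint_right.mp (Finset.disjoint_union_left.mpr ⟨hd2, hd4⟩) hx
      simp only [ind, hx, this, if_true, if_false]; ring
    · rw [lap_apply_eq_zero fun z => by linarith [hm1 x z (Or.inl hx), hsum x z]]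
      simp
  obtain ⟨hSA, hHA, hSH, hHS⟩ := calderon_identities hG hLp hLm (Matrix.diagonal_transpose _)
    (restr_mul_transpose_self dO) hR hGP hdec hRP hPLm
  have hCC : C * C = (1/4 : ℝ) • 1 := by
    rw [← fromBlocks_mul_self_of_calderon hSA hHA hSH hHS]
    have hsplit : restr dO * (lap σm * (green B σ * (restr dO)ᵀ)) =
        1 - restr dO * (lap σp * (green B σ * (restr dO)ᵀ)) := by
      have := congrArg (· * (restr dO)ᵀ) hR
      simp only [Matrix.mul_add, Matrix.add_mul, Matrix.mul_assoc,
        restr_mul_transpose_self] at this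
      rw [← this]; abel
    have hsplit' := congrArg Matrix.transpose hsplit
    simp only [Matrix.transpose_mul, Matrix.transpose_sub, Matrix.transpose_one,
      Matrix.transpose_transpose, hG, hLp, hLm, Matrix.mul_assoc] at hsplit'
    have hD : -(Dop B dO σ σp σm) =
        (restr dO * (lap σp * (green B σ * (restr dO)ᵀ)))ᵀ - (1/2 : ℝ) • 1 := by
      simp only [Dop, dlpP, dlpM, gamma0, gamma1p, gamma1m, Matrix.transpose_neg,
        Matrix.transpose_mul, Matrix.transpose_transpose, hG, hLp, hLm, Matrix.mul_neg,
        Matrix.mul_add, Matrix.mul_assoc, hsplit']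
      module
    have hD' : Dadj B dO σ σp σm =
        (1/2 : ℝ) • 1 - restr dO * (lap σp * (green B σ * (restr dO)ᵀ)) := by
      simp only [Dadj, slp, gamma0, gamma1p, gamma1m, Matrix.neg_mul, Matrix.add_mul,
        Matrix.mul_assoc, hsplit]
      module
    have hH : Hop B dO σ σp σm =
        restr dO * (lap σp * (green B σ * (lap σm * (restr dO)ᵀ))) := by
      simp only [Hop, dlpM, gamma1p, gamma1m, Matrix.neg_mul, neg_neg, Matrix.transpose_mul, hLm,
        Matrix.mul_assoc]
    rw [hC, hD, hD', hH, Sop, slp, gamma0]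
  refine ⟨?_, ?_, hCC⟩
  · rw [hPp]
    simp only [Matrix.mul_sub, Matrix.sub_mul, hCC, Matrix.smul_mul, Matrix.mul_smul,
      Matrix.mul_one, Matrix.one_mul]
    module
  · rw [hPm]
    simp only [Matrix.mul_add, Matrix.add_mul, hCC, Matrix.smul_mul, Matrix.mul_smul,
      Matrix.mul_one, Matrix.one_mul]
    module
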